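/- arXiv:0802.4017 — 7 statements merged into one kernel-verified Lean document; each statement's English description precedes it below -/
import Mathlib

section
/- Let k be an algebraically closed field and n ≥ 1. Let f ∈ k[T₁,…,Tₙ] be an irreducible polynomial and let g be a nonzero element of the rational function field k(T₁,…,Tₙ), written as g = p/q with nonzero polynomials p, q ∈ k[T₁,…,Tₙ]. Assume that g has neither zeroes nor poles outside the zero set of f, i.e. every point x ∈ kⁿ at which p or q vanishes satisfies f(x) = 0. Then there exist a constant c ∈ kˣ and an integer m ∈ ℤ such that g = c·f^m in k(T₁,…,Tₙ). -/
open MvPolynomial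

theorem dvd_helper (k : Type*) [Field k] [IsAlgClosed k] (n : ℕ)
    (f p : MvPolynomial (Fin n) k) (hf : Irreducible f)
    (h : ∀ x : Fin n → k, eval x p = 0 → eval x f = 0) :
    ∃ (c : kˣ) (i : ℕ), p = C (c : k) * f ^ i := by
  have hmem : f ∈ (Ideal.span {p}).radical := by
    rw [← vanishingIdeal_zeroLocus_eq_radical (K := k), mem_vanishingIdeal_iff]
    intro x hx
    have h1 := (mem_zeroLocus_iff.mp hx) p (Ideal.mem_span_singleton_self p)
    rw [aeval_eq_eval] at h1 ⊢
    exact h x h1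
  obtain ⟨N, hN⟩ := hmem
  rw [Ideal.mem_span_singleton] at hN
  obtain ⟨i, -, hi⟩ := (dvd_prime_pow hf.prime N).mp hN
  obtain ⟨u, hu⟩ := hi.symm
  obtain ⟨r, hr, hr'⟩ := (MvPolynomial.isUnit_iff_eq_C_of_isReduced).mp u.isUnit
  refine ⟨hr.unit, i, ?_⟩
  rw [← hu, hr', mul_comm]
  rfl

/-- **Lemma (InvSections).** Let `k` be an algebraically closed field and `n ≥ 1`.
If `f ∈ k[T₁,…,Tₙ]` is irreducible and `g = p/q` is a nonzero rational function
which has neither zeroes nor poles outside the zero set of `f`, then `g = c·f^m`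
for some constant `c ∈ kˣ` and some `m ∈ ℤ`. -/
theorem invariant_sections_lemma
    (k : Type*) [Field k] [IsAlgClosed k] (n : ℕ) (hn : 1 ≤ n)
    (f p q : MvPolynomial (Fin n) k) (hf : Irreducible f)
    (hp : p ≠ 0) (hq : q ≠ 0)
    (g : FractionRing (MvPolynomial (Fin n) k))
    (hg : g = algebraMap (MvPolynomial (Fin n) k) (FractionRing (MvPolynomial (Fin n) k)) p /
        algebraMap (MvPolynomial (Fin n) k) (FractionRing (MvPolynomial (Fin n) k)) q)
    (hzero : ∀ x : Fin n → k, (eval x p = 0 ∨ eval x q = 0) → eval x f = 0) :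
    ∃ (c : kˣ) (m : ℤ),
      g = algebraMap (MvPolynomial (Fin n) k) (FractionRing (MvPolynomial (Fin n) k)) (C (c : k)) *
        (algebraMap (MvPolynomial (Fin n) k) (FractionRing (MvPolynomial (Fin n) k)) f) ^ m := by
  obtain ⟨a, i, ha⟩ := dvd_helper k n f p hf (fun x hx => hzero x (Or.inl hx))
  obtain ⟨b, j, hb⟩ := dvd_helper k n f q hf (fun x hx => hzero x (Or.inr hx))
  set φ := algebraMap (MvPolynomial (Fin n) k) (FractionRing (MvPolynomial (Fin n) k)) with hφ
  have hinj : Function.Injective φ := IsFractionRing.injective _ _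
  have hf0 : φ f ≠ 0 := fun h0 => hf.ne_zero (hinj (by rw [h0, map_zero]))
  have hb0 : φ (C (b : k)) ≠ 0 := fun h0 =>
    b.ne_zero (C_injective _ _ ((hinj (by rw [h0, map_zero])).trans (C_0).symm))
  have hab : φ (C ((a * b⁻¹ : kˣ) : k)) * φ (C (b : k)) = φ (C (a : k)) := by
    rw [← map_mul, ← C_mul, ← Units.val_mul, inv_mul_cancel_right]
  refine ⟨a * b⁻¹, (i : ℤ) - j, ?_⟩
  rw [hg, ha, hb, map_mul, map_mul, map_pow, map_pow, zpow_sub₀ hf0, zpow_natCast, zpow_natCast,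
    ← hab]
  field_simp
end

section
/- Let n ≥ 1 and let k be a field containing a primitive n-th root of unity. Let d, h be positive integers and let Φ be a k-valued function on the set of homogeneous polynomials of degree d in n variables over k such that Φ(λF) = λ^h·Φ(F) for every λ ∈ kˣ, and Φ(F ∘ v) = Φ(F) for every v ∈ SL_n(k). If Φ(F₀) ≠ 0 for some homogeneous F₀ of degree d, then n divides d·h. -/
open MvPolynomial

/-- The substitution action of a matrix `u` on polynomials: `(F ∘ u)(x) = F(u·x)`. -/
noncomputable def matrixSubst {k : Type*} [CommSemiring k] {n : ℕ}
    (u : Matrix (Fin n) (Fin n) k) (F : MvPolynomial (Fin n) k) : MvPolynomial (Fin n) k :=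
  MvPolynomial.aeval (fun i => ∑ j, MvPolynomial.C (u i j) * MvPolynomial.X j) F

theorem matrixSubst_scalar {k : Type*} [Field k] {n d : ℕ} (z : k)
    (F : MvPolynomial (Fin n) k) (hF : F.IsHomogeneous d) :
    matrixSubst (z • (1 : Matrix (Fin n) (Fin n) k)) F = (z ^ d) • F := by
  have h1 : ∀ i : Fin n, (∑ j, C ((z • (1 : Matrix (Fin n) (Fin n) k)) i j) * X j
      : MvPolynomial (Fin n) k) = C z * X i := by
    intro i
    rw [Finset.sum_eq_single i]
    · simp
    · intro j _ hj
      simp [Matrix.one_apply_ne hj.symm]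
    · simp
  unfold matrixSubst
  simp only [h1]
  conv_rhs => rw [F.as_sum]
  conv_lhs => rw [F.as_sum]
  rw [map_sum, Finset.smul_sum]
  refine Finset.sum_congr rfl fun m hm => ?_
  have hdeg : m.degree = d := by
    have := hF (mem_support_iff.mp hm)
    rwa [Finsupp.degree_eq_weight_one]
  rw [aeval_monomial, Finsupp.prod]
  simp only [mul_pow, Finset.prod_mul_distrib]
  rw [Finset.prod_pow_eq_pow_sum]
  have hs : ∑ i ∈ m.support, m i = d := hdeg
  rw [hs, monomial_eq, Finsupp.prod, smul_eq_C_mul, C_pow, algebraMap_eq]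
  ring

/-- If `k` contains a primitive `n`-th root of unity and `Φ` is a nonzero invariant of
degree `h` on forms of degree `d` in `n` variables, then `n` divides `d·h`. -/
theorem invariant_degree_divisibility
    (k : Type*) [Field k] (n d h : ℕ) (hn : 1 ≤ n) (hd : 0 < d) (hh : 0 < h)
    (hroot : ∃ ζ : k, IsPrimitiveRoot ζ n)
    (Φ : MvPolynomial (Fin n) k → k)
    (hhom : ∀ (lam : kˣ) (F : MvPolynomial (Fin n) k), F.IsHomogeneous d →
      Φ ((lam : k) • F) = (lam : k) ^ h * Φ F)
    (hinv : ∀ v : Matrix (Fin n) (Fin n) k, v.det = 1 →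
      ∀ F : MvPolynomial (Fin n) k, F.IsHomogeneous d → Φ (matrixSubst v F) = Φ F)
    (F₀ : MvPolynomial (Fin n) k) (hF₀ : F₀.IsHomogeneous d) (hΦF₀ : Φ F₀ ≠ 0) :
    n ∣ d * h := by
  obtain ⟨z, hz⟩ := hroot
  have hz0 : z ≠ 0 := hz.ne_zero (by omega)
  have hdet : (z • (1 : Matrix (Fin n) (Fin n) k)).det = 1 := by
    rw [Matrix.det_smul, Matrix.det_one, Fintype.card_fin, hz.pow_eq_one, mul_one]
  have e1 := hinv _ hdet F₀ hF₀
  rw [matrixSubst_scalar z F₀ hF₀] at e1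
  have e2 := hhom (Units.mk0 z hz0 ^ d) F₀ hF₀
  simp only [Units.val_pow_eq_pow_val, Units.val_mk0] at e2
  rw [e1, ← pow_mul] at e2
  exact hz.dvd_of_pow_eq_one _ (mul_right_cancel₀ hΦF₀ (by rw [one_mul]; exact e2.symm))
end

section
/- Let k be an algebraically closed field of characteristic different from 2. Let m be a symmetric 3×3 matrix over k with diagonal entries a₁, a₂, a₃ and off-diagonal entries b₃ (position (1,2)), b₂ (position (1,3)), b₁ (position (2,3)), and let F_m(x,y,z) = a₁x⁴ + a₂y⁴ + a₃z⁴ + 2(b₁y²z² + b₂x²z² + b₃x²y²). For 1 ≤ i ≤ 3 let c_i = a_j·a_k − b_i² (with {i,j,k} = {1,2,3}) be the cofactor of a_i in m. Then the projective plane curve F_m = 0 is singular — i.e. there exists (x,y,z) ∈ k³, (x,y,z) ≠ (0,0,0), at which all three partial derivatives ∂F_m/∂x, ∂F_m/∂y, ∂F_m/∂z vanish — if and only if a₁·a₂·a₃·c₁·c₂·c₃·det(m) = 0. -/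
open MvPolynomial

theorem ciani_aux {k : Type*} [Field k] [IsAlgClosed k] (a b d : k) (h : a * d - b ^ 2 = 0) :
    ∃ s t : k, (s ≠ 0 ∨ t ≠ 0) ∧ a * s ^ 2 + b * t ^ 2 = 0 ∧ b * s ^ 2 + d * t ^ 2 = 0 := by
  by_cases ha : a = 0
  · subst ha
    have hb : b = 0 := by
      have : b ^ 2 = 0 := by linear_combination -h
      exact pow_eq_zero_iff (two_ne_zero) |>.1 this
    exact ⟨1, 0, Or.inl one_ne_zero, by simp, by simp [hb]⟩
  · obtain ⟨s, hs⟩ := IsAlgClosed.exists_pow_nat_eq (-b) (n := 2) (by norm_num)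
    obtain ⟨t, ht⟩ := IsAlgClosed.exists_pow_nat_eq a (n := 2) (by norm_num)
    refine ⟨s, t, Or.inr ?_, ?_, ?_⟩
    · rintro rfl
      apply ha
      rw [← ht]; simp
    · rw [hs, ht]; ring
    · rw [hs, ht]; linear_combination h

theorem ciani_partials {k : Type*} [Field k] (h2 : (2 : k) ≠ 0) (a₁ a₂ a₃ b₁ b₂ b₃ : k)
    (p : Fin 3 → k) (F : MvPolynomial (Fin 3) k)
    (hF : F = C a₁ * X 0 ^ 4 + C a₂ * X 1 ^ 4 + C a₃ * X 2 ^ 4 +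
      2 * (C b₁ * X 1 ^ 2 * X 2 ^ 2 + C b₂ * X 0 ^ 2 * X 2 ^ 2 + C b₃ * X 0 ^ 2 * X 1 ^ 2)) :
    (∀ i : Fin 3, eval p (pderiv i F) = 0) ↔
      (p 0 * (a₁ * p 0 ^ 2 + b₃ * p 1 ^ 2 + b₂ * p 2 ^ 2) = 0 ∧
       p 1 * (b₃ * p 0 ^ 2 + a₂ * p 1 ^ 2 + b₁ * p 2 ^ 2) = 0 ∧
       p 2 * (b₂ * p 0 ^ 2 + b₁ * p 1 ^ 2 + a₃ * p 2 ^ 2) = 0) := by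
  have h4 : (2 * 2 : k) ≠ 0 := mul_ne_zero h2 h2
  have hF' : F = C a₁ * X 0 ^ 4 + C a₂ * X 1 ^ 4 + C a₃ * X 2 ^ 4 +
      C 2 * (C b₁ * X 1 ^ 2 * X 2 ^ 2 + C b₂ * X 0 ^ 2 * X 2 ^ 2 + C b₃ * X 0 ^ 2 * X 1 ^ 2) := by
    rw [hF, show (C 2 : MvPolynomial (Fin 3) k) = 2 from map_ofNat C 2]
  have e0 : eval p (pderiv 0 F) =
      2 * 2 * (p 0 * (a₁ * p 0 ^ 2 + b₃ * p 1 ^ 2 + b₂ * p 2 ^ 2)) := by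
    rw [hF']
    simp only [map_add, Derivation.leibniz, Derivation.leibniz_pow, pderiv_C, pderiv_X, smul_eq_mul,
      nsmul_eq_mul, map_mul, map_pow, eval_C, eval_X]
    simp
    ring
  have e1 : eval p (pderiv 1 F) =
      2 * 2 * (p 1 * (b₃ * p 0 ^ 2 + a₂ * p 1 ^ 2 + b₁ * p 2 ^ 2)) := by
    rw [hF']
    simp only [map_add, Derivation.leibniz, Derivation.leibniz_pow, pderiv_C, pderiv_X, smul_eq_mul,
      nsmul_eq_mul, map_mul, map_pow, eval_C, eval_X]
    simp
    ring
  have e2 : eval p (pderiv 2 F) =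
      2 * 2 * (p 2 * (b₂ * p 0 ^ 2 + b₁ * p 1 ^ 2 + a₃ * p 2 ^ 2)) := by
    rw [hF']
    simp only [map_add, Derivation.leibniz, Derivation.leibniz_pow, pderiv_C, pderiv_X, smul_eq_mul,
      nsmul_eq_mul, map_mul, map_pow, eval_C, eval_X]
    simp
    ring
  rw [Fin.forall_fin_succ, Fin.forall_fin_succ, Fin.forall_fin_succ]
  change (eval p (pderiv 0 F) = 0 ∧ eval p (pderiv 1 F) = 0 ∧ eval p (pderiv 2 F) = 0 ∧ _) ↔ _
  rw [e0, e1, e2]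
  simp only [mul_eq_zero_iff_left h4, mul_eq_zero]
  simp

/-- Nondegenerate 2 by 2 symmetric systems have no solution in nonzero scalars. -/
theorem ciani_two {k : Type*} [Field k] (a b d u v : k) (hu : u ≠ 0)
    (h : a * u + b * v = 0) (h' : b * u + d * v = 0) : a * d - b ^ 2 = 0 := by
  have : u * (a * d - b ^ 2) = 0 := by linear_combination d * h - b * h'
  exact (mul_eq_zero.1 this).resolve_left hu

/-- **Singularity criterion for Ciani quartics.** Over an algebraically closed field of
characteristic ≠ 2, the Ciani quartic `F_m` is singular iff
`a₁a₂a₃·c₁c₂c₃·det(m) = 0`, where `cᵢ` are the cofactors of the diagonal entries. -/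
theorem ciani_singular_iff (k : Type*) [Field k] [IsAlgClosed k] (h2 : (2 : k) ≠ 0)
    (a₁ a₂ a₃ b₁ b₂ b₃ : k)
    (m : Matrix (Fin 3) (Fin 3) k)
    (hm : m = Matrix.of ![![a₁, b₃, b₂], ![b₃, a₂, b₁], ![b₂, b₁, a₃]])
    (F : MvPolynomial (Fin 3) k)
    (hF : F = C a₁ * X 0 ^ 4 + C a₂ * X 1 ^ 4 + C a₃ * X 2 ^ 4 +
      2 * (C b₁ * X 1 ^ 2 * X 2 ^ 2 + C b₂ * X 0 ^ 2 * X 2 ^ 2 + C b₃ * X 0 ^ 2 * X 1 ^ 2))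
    (c₁ c₂ c₃ : k)
    (hc₁ : c₁ = a₂ * a₃ - b₁ ^ 2) (hc₂ : c₂ = a₁ * a₃ - b₂ ^ 2) (hc₃ : c₃ = a₁ * a₂ - b₃ ^ 2) :
    (∃ p : Fin 3 → k, p ≠ 0 ∧ ∀ i : Fin 3, eval p (pderiv i F) = 0) ↔
      a₁ * a₂ * a₃ * c₁ * c₂ * c₃ * m.det = 0 := by
  have hdet : m.det = a₁ * (a₂ * a₃ - b₁ ^ 2) - b₃ * (b₃ * a₃ - b₁ * b₂)
      + b₂ * (b₃ * b₁ - a₂ * b₂) := by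
    rw [hm, Matrix.det_fin_three]
    simp
    ring
  have key := fun p => ciani_partials h2 a₁ a₂ a₃ b₁ b₂ b₃ p F hF
  simp only [key]
  constructor
  · rintro ⟨p, hp, h0, h1, h3⟩
    generalize hx : p 0 = x at *
    generalize hy : p 1 = y at *
    generalize hz : p 2 = z at *
    simp only [mul_eq_zero (M₀ := k)]
    by_cases x0 : x = 0 <;> by_cases y0 : y = 0 <;> by_cases z0 : z = 0
    · exfalso
      apply hp
      funext i
      fin_cases i
      · exact hx.trans x0
      · exact hy.trans y0
      · exact hz.trans z0
    · have : a₃ = 0 := by simpa [x0, y0, z0] using h3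
      tauto
    · have : a₂ = 0 := by simpa [x0, y0, z0] using h1
      tauto
    · have := ciani_two a₂ b₁ a₃ (y ^ 2) (z ^ 2) (pow_ne_zero 2 y0)
        (by simpa [x0, y0] using h1) (by simpa [x0, z0] using h3)
      rw [← hc₁] at this
      tauto
    · have : a₁ = 0 := by simpa [x0, y0, z0] using h0
      tauto
    · have := ciani_two a₁ b₂ a₃ (x ^ 2) (z ^ 2) (pow_ne_zero 2 x0)
        (by simpa [x0, y0] using h0) (by simpa [y0, z0] using h3)
      rw [← hc₂] at this
      tauto
    · have := ciani_two a₁ b₃ a₂ (x ^ 2) (y ^ 2) (pow_ne_zero 2 x0)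
        (by simpa [x0, z0] using h0) (by simpa [y0, z0] using h1)
      rw [← hc₃] at this
      tauto
    · have g0 := (mul_eq_zero.1 h0).resolve_left x0
      have g1 := (mul_eq_zero.1 h1).resolve_left y0
      have g3 := (mul_eq_zero.1 h3).resolve_left z0
      right
      have : x ^ 2 * m.det = 0 := by
        rw [hdet]
        linear_combination (a₂ * a₃ - b₁ ^ 2) * g0 - (b₃ * a₃ - b₁ * b₂) * g1
          + (b₃ * b₁ - a₂ * b₂) * g3
      exact (mul_eq_zero.1 this).resolve_left (pow_ne_zero 2 x0)
  · intro h
    suffices H : ∃ x y z : k, (x ≠ 0 ∨ y ≠ 0 ∨ z ≠ 0) ∧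
        x * (a₁ * x ^ 2 + b₃ * y ^ 2 + b₂ * z ^ 2) = 0 ∧
        y * (b₃ * x ^ 2 + a₂ * y ^ 2 + b₁ * z ^ 2) = 0 ∧
        z * (b₂ * x ^ 2 + b₁ * y ^ 2 + a₃ * z ^ 2) = 0 by
      obtain ⟨x, y, z, hne, e0, e1, e2⟩ := H
      refine ⟨![x, y, z], ?_, e0, e1, e2⟩
      intro hp
      have q0 : x = 0 := congrFun hp 0
      have q1 : y = 0 := congrFun hp 1
      have q2 : z = 0 := congrFun hp 2
      tauto
    simp only [mul_eq_zero (M₀ := k)] at h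
    rcases h with (((((h | h) | h) | h) | h) | h) | h
    · exact ⟨1, 0, 0, by simp, by simp [h], by simp, by simp⟩
    · exact ⟨0, 1, 0, by simp, by simp, by simp [h], by simp⟩
    · exact ⟨0, 0, 1, by simp, by simp, by simp, by simp [h]⟩
    · obtain ⟨s, t, hne, e, e'⟩ := ciani_aux a₂ b₁ a₃ (hc₁ ▸ h)
      exact ⟨0, s, t, by tauto, by simp, by linear_combination s * e, by linear_combination t * e'⟩
    · obtain ⟨s, t, hne, e, e'⟩ := ciani_aux a₁ b₂ a₃ (hc₂ ▸ h)
      exact ⟨s, 0, t, by tauto, by linear_combination s * e, by simp, by linear_combination t * e'⟩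
    · obtain ⟨s, t, hne, e, e'⟩ := ciani_aux a₁ b₃ a₂ (hc₃ ▸ h)
      exact ⟨s, t, 0, by tauto, by linear_combination s * e, by linear_combination t * e', by simp⟩
    · obtain ⟨v, hv, hmv⟩ := Matrix.exists_mulVec_eq_zero_iff.2 h
      have r0 := congrFun hmv 0
      have r1 := congrFun hmv 1
      have r2 := congrFun hmv 2
      simp [hm, Matrix.mulVec, dotProduct, Fin.sum_univ_three] at r0 r1 r2
      choose r hr using fun i => IsAlgClosed.exists_pow_nat_eq (v i) (n := 2) (by norm_num)
      refine ⟨r 0, r 1, r 2, ?_, ?_, ?_, ?_⟩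
      · by_contra! hc
        apply hv
        funext i
        rw [← hr i]
        fin_cases i <;> simp [hc]
      · rw [hr, hr, hr]; linear_combination r 0 * r0
      · rw [hr, hr, hr]; linear_combination r 1 * r1
      · rw [hr, hr, hr]; linear_combination r 2 * r2
end

section
/- Let g ≥ 1, let τ be a symmetric g×g complex matrix whose imaginary part is positive definite, let z ∈ ℂ^g and let a, b ∈ ℝ^g. Then the family indexed by n ∈ ℤ^g with terms exp(πi·ᵗ(n+a)·τ·(n+a) + 2πi·ᵗ(n+a)·(z+b)) is absolutely summable. -/
open Complex

lemma summable_prod_pi_aux (g : ℕ) (f : Fin g → ℤ → ℝ) (h0 : ∀ i n, 0 ≤ f i n)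
    (hf : ∀ i, Summable (f i)) : Summable (fun n : Fin g → ℤ => ∏ i, f i (n i)) := by
  induction g with
  | zero => exact Summable.of_finite
  | succ g ih =>
    rw [← (Fin.consEquiv (fun _ : Fin (g+1) => ℤ)).summable_iff]
    have h1 := ih (fun i => f i.succ) (fun i => h0 _) (fun i => hf _)
    have h2 := Summable.mul_of_nonneg (hf 0) h1 (fun n => h0 _ n)
      (fun n => Finset.prod_nonneg fun i _ => h0 _ _)
    refine h2.congr fun p => ?_
    simp [Fin.consEquiv, Fin.prod_univ_succ]

lemma posDef_lower_bound_aux (g : ℕ) (Y : Matrix (Fin g) (Fin g) ℝ) (hY : Y.PosDef) :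
    ∃ c : ℝ, 0 < c ∧ ∀ x : Fin g → ℝ,
      c * ∑ i, x i ^ 2 ≤ ∑ i, ∑ j, x i * Y i j * x j := by
  have hQ : ∀ x : Fin g → ℝ, x ≠ 0 → 0 < ∑ i, ∑ j, x i * Y i j * x j := by
    intro x hx
    have := hY.dotProduct_mulVec_pos hx
    simpa [dotProduct, Matrix.mulVec, Finset.mul_sum, mul_assoc] using this
  let Q : EuclideanSpace ℝ (Fin g) → ℝ := fun x => ∑ i, ∑ j, x i * Y i j * x j
  have hc : Continuous Q := by fun_prop
  have key : ∃ c : ℝ, 0 < c ∧ ∀ x ∈ Metric.sphere (0 : EuclideanSpace ℝ (Fin g)) 1, c ≤ Q x := by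
    rcases (Metric.sphere (0 : EuclideanSpace ℝ (Fin g)) 1).eq_empty_or_nonempty with he | hne
    · exact ⟨1, one_pos, by simp [he]⟩
    · obtain ⟨x, hx, hm⟩ := (isCompact_sphere (0 : EuclideanSpace ℝ (Fin g)) 1).exists_isMinOn
        hne hc.continuousOn
      refine ⟨Q x, hQ _ ?_, fun y hy => hm hy⟩
      intro h
      have : x = 0 := by ext i; exact congrFun h i
      simp [this] at hx
  obtain ⟨c, hc0, hcQ⟩ := key
  refine ⟨c, hc0, fun x => ?_⟩
  by_cases hx : x = 0
  · simp [hx]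
  let v : EuclideanSpace ℝ (Fin g) := WithLp.toLp 2 x
  have hv : v ≠ 0 := fun h => hx (by ext i; exact congrArg (fun w : EuclideanSpace ℝ (Fin g) => w i) h)
  have hn : 0 < ‖v‖ := norm_pos_iff.2 hv
  have h1 := hcQ (‖v‖⁻¹ • v) (by simp [norm_smul, hn.ne'])
  have h2 : Q (‖v‖⁻¹ • v) = (‖v‖⁻¹) ^ 2 * ∑ i, ∑ j, x i * Y i j * x j := by
    simp only [Q, Finset.mul_sum]
    refine Finset.sum_congr rfl fun i _ => Finset.sum_congr rfl fun j _ => ?_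
    simp only [PiLp.smul_apply, smul_eq_mul, v]
    ring
  have h3 : ∑ i, x i ^ 2 = ‖v‖ ^ 2 := by
    rw [EuclideanSpace.norm_sq_eq]; simp [v]
  rw [h3]
  rw [h2, inv_pow, ← div_eq_inv_mul, le_div_iff₀ (by positivity)] at h1
  exact h1

lemma summable_gauss_aux (c a y : ℝ) (hc : 0 < c) :
    Summable (fun n : ℤ => Real.exp (-Real.pi * c * (n + a) ^ 2 - 2 * Real.pi * ((n + a) * y))) := by
  have h := ((summable_jacobiTheta₂_term_iff (((c * a + y : ℝ) : ℂ) * I) ((c : ℂ) * I)).2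
    (by simpa using hc)).norm
  refine (h.mul_left (Real.exp (-Real.pi * c * a ^ 2 - 2 * Real.pi * (a * y)))).congr fun n => ?_
  rw [norm_jacobiTheta₂_term, ← Real.exp_add]
  congr 1
  simp
  ring

/-- **Absolute convergence of the theta series.** For `τ` in the Siegel upper half
space `H_g`, `z ∈ ℂ^g` and real characteristics `a, b ∈ ℝ^g`, the family
`n ↦ exp(πi·ᵗ(n+a)·τ·(n+a) + 2πi·ᵗ(n+a)·(z+b))`, indexed by `n ∈ ℤ^g`, is
absolutely summable. -/
theorem theta_series_absolutely_summable
    (g : ℕ) (hg : 1 ≤ g) (τ : Matrix (Fin g) (Fin g) ℂ)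
    (hsymm : τ.IsSymm)
    (hpos : (Matrix.of fun i j => (τ i j).im).PosDef)
    (z : Fin g → ℂ) (a b : Fin g → ℝ) :
    Summable (fun n : Fin g → ℤ =>
      ‖Complex.exp ((Real.pi : ℂ) * Complex.I *
          (∑ i, ∑ j, ((n i : ℂ) + (a i : ℂ)) * τ i j * ((n j : ℂ) + (a j : ℂ))) +
        2 * (Real.pi : ℂ) * Complex.I *
          (∑ i, ((n i : ℂ) + (a i : ℂ)) * (z i + (b i : ℂ))))‖) := by
  obtain ⟨c, hc, hY⟩ := posDef_lower_bound_aux g _ hpos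
  refine Summable.of_nonneg_of_le (fun n => norm_nonneg _) (fun n => ?_)
    (summable_prod_pi_aux g
      (fun i n => Real.exp (-Real.pi * c * (n + a i) ^ 2 - 2 * Real.pi * ((n + a i) * (z i).im)))
      (fun i n => (Real.exp_pos _).le) (fun i => summable_gauss_aux c (a i) (z i).im hc))
  rw [Complex.norm_exp, ← Real.exp_sum, Real.exp_le_exp]
  have h := hY (fun i => n i + a i)
  have e1 : (∑ i, ∑ j, ((n i : ℂ) + (a i : ℂ)) * τ i j * ((n j : ℂ) + (a j : ℂ))).im
      = ∑ i, ∑ j, ((n i : ℝ) + a i) * (τ i j).im * ((n j : ℝ) + a j) := by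
    simp [Complex.im_sum]
  have e2 : (∑ i, ((n i : ℂ) + (a i : ℂ)) * (z i + (b i : ℂ))).im
      = ∑ i, ((n i : ℝ) + a i) * (z i).im := by
    simp [Complex.im_sum]
  have e3 : ∀ A B : ℂ, ((Real.pi : ℂ) * Complex.I * A + 2 * (Real.pi : ℂ) * Complex.I * B).re
      = - Real.pi * A.im - 2 * Real.pi * B.im := by
    intro A B
    simp
    ring
  rw [e3, e1, e2, Finset.sum_sub_distrib, ← Finset.mul_sum, ← Finset.mul_sum]
  simp only [Matrix.of_apply] at h
  nlinarith [mul_le_mul_of_nonneg_left h Real.pi_pos.le]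
end

section
/- Let g ≥ 1, let τ be a symmetric g×g complex matrix whose imaginary part is positive definite, and let M ∈ Sp(2g,ℝ) with g×g blocks a, b, c, d. Then the matrix M·τ = (aτ+b)(cτ+d)⁻¹ is again symmetric and its imaginary part is positive definite; i.e. the formula M·τ = (aτ+b)(cτ+d)⁻¹ defines a map of H_g to itself. -/
open Matrix
open scoped ComplexOrder

/-- A real matrix is positive definite iff its complexification is. -/
theorem posDef_ofReal_iff {g : ℕ} (Y : Matrix (Fin g) (Fin g) ℝ) :
    (Y.map (Complex.ofReal : ℝ → ℂ)).PosDef ↔ Y.PosDef := by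
  have hre : ∀ z : Fin g → ℂ, (star z ⬝ᵥ (Y.map (Complex.ofReal : ℝ → ℂ) *ᵥ z)).re =
      (fun i => (z i).re) ⬝ᵥ (Y *ᵥ fun i => (z i).re) +
      (fun i => (z i).im) ⬝ᵥ (Y *ᵥ fun i => (z i).im) := by
    intro z
    simp only [dotProduct, mulVec, Finset.mul_sum, Complex.re_sum, ← Finset.sum_add_distrib]
    refine Finset.sum_congr rfl fun i _ => Finset.sum_congr rfl fun j _ => ?_
    simp
  constructor
  · intro h
    refine .of_dotProduct_mulVec_pos ?_ fun x hx => ?_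
    · ext i j
      have := congrFun (congrFun h.1 i) j
      simpa using this
    · have hx' : (fun i => (x i : ℂ)) ≠ 0 := by
        intro h0
        apply hx
        funext i
        simpa using congrFun h0 i
      have h1 := (Complex.lt_def.1 (h.dotProduct_mulVec_pos hx')).1
      rw [hre] at h1
      have h2 : Y *ᵥ (fun _ => (0:ℝ)) = 0 := mulVec_zero Y
      simpa [h2] using h1
  · intro h
    have hH : (Y.map (Complex.ofReal : ℝ → ℂ)).IsHermitian := by
      ext i j
      have := congrFun (congrFun h.1 i) j
      simpa using this
    refine .of_dotProduct_mulVec_pos hH fun z hz => ?_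
    have him := hH.im_star_dotProduct_mulVec_self z
    refine Complex.lt_def.2 ⟨?_, by simpa using him.symm⟩
    rw [hre, Complex.zero_re]
    have nn : ∀ x : Fin g → ℝ, 0 ≤ x ⬝ᵥ (Y *ᵥ x) := fun x => by
      simpa using h.posSemidef.dotProduct_mulVec_nonneg x
    have pp : ∀ x : Fin g → ℝ, x ≠ 0 → 0 < x ⬝ᵥ (Y *ᵥ x) := fun x hx => by
      simpa using h.dotProduct_mulVec_pos hx
    by_cases h0 : (fun i => (z i).re) = 0
    · have h1 : (fun i => (z i).im) ≠ 0 := by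
        intro h1
        apply hz
        funext i
        exact Complex.ext (congrFun h0 i) (congrFun h1 i)
      exact add_pos_of_nonneg_of_pos (nn _) (pp _ h1)
    · exact add_pos_of_pos_of_nonneg (pp _ h0) (nn _)

/-- For a symmetric matrix, `S - Sᴴ` is `2i` times the imaginary part. -/
theorem sub_conjTranspose_eq {g : ℕ} (S : Matrix (Fin g) (Fin g) ℂ) (hS : S.IsSymm) :
    S - Sᴴ = (2 * Complex.I) •
      (Matrix.of fun i j => (S i j).im).map (Complex.ofReal : ℝ → ℂ) := by
  ext i j
  have h : S j i = S i j := hS.apply i j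
  simp only [Matrix.sub_apply, conjTranspose_apply, h, Matrix.smul_apply, Matrix.map_apply, of_apply, smul_eq_mul]
  apply Complex.ext <;> simp
  ring



/-- For `M ∈ Sp(2g,ℝ)` with blocks `a, b, c, d` and `τ` in the Siegel upper half
space `H_g`, the matrix `M·τ = (aτ+b)(cτ+d)⁻¹` is symmetric with positive definite
imaginary part, i.e. `M·τ` again lies in `H_g`. -/
theorem symplectic_action_maps_siegel_to_siegel
    (g : ℕ) (hg : 1 ≤ g)
    (τ : Matrix (Fin g) (Fin g) ℂ)
    (hsymm : τ.IsSymm)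
    (hpos : (Matrix.of fun i j => (τ i j).im).PosDef)
    (M : Matrix (Fin g ⊕ Fin g) (Fin g ⊕ Fin g) ℝ)
    (hM : Mᵀ * Matrix.fromBlocks 0 1 (-1) 0 * M = Matrix.fromBlocks 0 1 (-1) 0)
    (A B C D : Matrix (Fin g) (Fin g) ℂ)
    (hA : A = (M.toBlocks₁₁).map (Complex.ofReal : ℝ → ℂ))
    (hB : B = (M.toBlocks₁₂).map (Complex.ofReal : ℝ → ℂ))
    (hC : C = (M.toBlocks₂₁).map (Complex.ofReal : ℝ → ℂ))
    (hD : D = (M.toBlocks₂₂).map (Complex.ofReal : ℝ → ℂ)) :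
    ((A * τ + B) * (C * τ + D)⁻¹).IsSymm ∧
    (Matrix.of fun i j => (((A * τ + B) * (C * τ + D)⁻¹) i j).im).PosDef := by
  have hM' : fromBlocks M.toBlocks₁₁ M.toBlocks₁₂ M.toBlocks₂₁ M.toBlocks₂₂ = M :=
    fromBlocks_toBlocks M
  rw [← hM', fromBlocks_transpose, fromBlocks_multiply, fromBlocks_multiply] at hM
  obtain ⟨e1, e2, e3, e4⟩ := fromBlocks_inj.1 hM
  have key : ∀ X Y : Matrix (Fin g) (Fin g) ℝ, (X * Y).map (Complex.ofReal : ℝ → ℂ) =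
      X.map (Complex.ofReal : ℝ → ℂ) * Y.map (Complex.ofReal : ℝ → ℂ) := fun X Y =>
    Matrix.map_mul (f := Complex.ofRealHom)
  have f1 : Aᵀ * C = Cᵀ * A := by
    rw [hA, hC, ← transpose_map, ← transpose_map, ← key, ← key]
    congr 1
    simp at e1
    grind
  have f2 : Aᵀ * D = 1 + Cᵀ * B := by
    have : M.toBlocks₁₁ᵀ * M.toBlocks₂₂ = 1 + M.toBlocks₂₁ᵀ * M.toBlocks₁₂ := by
      simp at e2
      grind
    rw [hA, hC, hB, hD, ← transpose_map, ← transpose_map, ← key, ← key, this,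
      Matrix.map_add _ Complex.ofReal_add, Matrix.map_one _ Complex.ofReal_zero Complex.ofReal_one]
  have f3 : Dᵀ * A = 1 + Bᵀ * C := by
    simpa using congrArg transpose f2
  have f4 : Bᵀ * D = Dᵀ * B := by
    rw [hB, hD, ← transpose_map, ← transpose_map, ← key, ← key]
    congr 1
    simp at e4
    grind
  have cj : ∀ X : Matrix (Fin g) (Fin g) ℝ, (X.map (Complex.ofReal : ℝ → ℂ))ᴴ =
      (X.map (Complex.ofReal : ℝ → ℂ))ᵀ := fun X => by
    ext i j
    simp
  have cA : Aᴴ = Aᵀ := by rw [hA, cj]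
  have cB : Bᴴ = Bᵀ := by rw [hB, cj]
  have cC : Cᴴ = Cᵀ := by rw [hC, cj]
  have cD : Dᴴ = Dᵀ := by rw [hD, cj]
  -- the two fundamental identities
  have gen : ∀ T : Matrix (Fin g) (Fin g) ℂ,
      (T * Cᵀ + Dᵀ) * (A * τ + B) - (T * Aᵀ + Bᵀ) * (C * τ + D) = τ - T := by
    intro T
    have : (T * Cᵀ + Dᵀ) * (A * τ + B) - (T * Aᵀ + Bᵀ) * (C * τ + D) =
        T * (Cᵀ * A - Aᵀ * C) * τ + T * (Cᵀ * B - Aᵀ * D) + (Dᵀ * A - Bᵀ * C) * τ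
          + (Dᵀ * B - Bᵀ * D) := by noncomm_ring
    rw [this, f1, f2, f3, f4]
    noncomm_ring
  set P := A * τ + B with hP
  set Q := C * τ + D with hQ
  have g1 : Qᵀ * P = Pᵀ * Q := by
    have := gen τ
    rw [sub_self, sub_eq_zero] at this
    rw [hQ, hP, transpose_add, transpose_add, transpose_mul, transpose_mul, hsymm.eq]
    exact this
  have g2 : Qᴴ * P - Pᴴ * Q = τ - τᴴ := by
    rw [hQ, hP, conjTranspose_add, conjTranspose_add, conjTranspose_mul, conjTranspose_mul,
      cA, cB, cC, cD]
    exact gen τᴴ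
  rw [sub_conjTranspose_eq τ hsymm] at g2
  have h2I : (2 * Complex.I) ≠ 0 := by simp
  have hY := (posDef_ofReal_iff _).2 hpos
  set Y := (Matrix.of fun i j => (τ i j).im).map (Complex.ofReal : ℝ → ℂ)
  have hdet : IsUnit Q.det := by
    rw [isUnit_iff_ne_zero]
    intro h0
    obtain ⟨v, hv, hQv⟩ := exists_mulVec_eq_zero_iff.2 h0
    have hlt := hY.dotProduct_mulVec_pos hv
    have hz : star v ⬝ᵥ ((Qᴴ * P - Pᴴ * Q) *ᵥ v) = 0 := by
      have hs : star v ᵥ* Qᴴ = 0 := by rw [← star_mulVec, hQv, star_zero]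
      rw [sub_mulVec, ← mulVec_mulVec, ← mulVec_mulVec, hQv, mulVec_zero, sub_zero,
        dotProduct_mulVec, hs, zero_dotProduct]
    rw [g2, smul_mulVec, dotProduct_smul, smul_eq_mul] at hz
    rcases mul_eq_zero.1 hz with h | h
    · exact h2I h
    · exact hlt.ne' h
  have hQQ : Q * Q⁻¹ = 1 := mul_nonsing_inv Q hdet
  have hT : Q⁻¹ᵀ * Qᵀ = 1 := by rw [← transpose_mul, hQQ, transpose_one]
  have hH : Q⁻¹ᴴ * Qᴴ = 1 := by rw [← conjTranspose_mul, hQQ, conjTranspose_one]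
  have hS : (P * Q⁻¹).IsSymm := by
    calc (P * Q⁻¹)ᵀ = Q⁻¹ᵀ * Pᵀ * (Q * Q⁻¹) := by rw [hQQ, mul_one, transpose_mul]
      _ = Q⁻¹ᵀ * (Pᵀ * Q) * Q⁻¹ := by noncomm_ring
      _ = (Q⁻¹ᵀ * Qᵀ) * (P * Q⁻¹) := by rw [← g1]; noncomm_ring
      _ = P * Q⁻¹ := by rw [hT, one_mul]
  refine ⟨hS, (posDef_ofReal_iff _).1 ?_⟩
  have hfin : (2 * Complex.I) •
      (Matrix.of fun i j => ((P * Q⁻¹) i j).im).map (Complex.ofReal : ℝ → ℂ) =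
      (2 * Complex.I) • (Q⁻¹ᴴ * Y * Q⁻¹) := by
    rw [← sub_conjTranspose_eq _ hS]
    calc P * Q⁻¹ - (P * Q⁻¹)ᴴ = (Q⁻¹ᴴ * Qᴴ) * (P * Q⁻¹) - Q⁻¹ᴴ * Pᴴ * (Q * Q⁻¹) := by
          rw [hQQ, hH, mul_one, one_mul, conjTranspose_mul]
      _ = Q⁻¹ᴴ * (Qᴴ * P - Pᴴ * Q) * Q⁻¹ := by noncomm_ring
      _ = _ := by rw [g2, mul_smul_comm, smul_mul_assoc]
  rw [smul_right_injective _ h2I hfin]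
  refine hY.conjTranspose_mul_mul_same (mulVec_injective_of_isUnit ?_)
  exact (isUnit_iff_isUnit_det _).2 (isUnit_nonsing_inv_det Q hdet)
end

section
/- Let g ≥ 1, let τ be a symmetric g×g complex matrix whose imaginary part is positive definite, and let M ∈ Sp(2g,ℤ) with g×g blocks a, b, c, d. Then the invertible complex-linear map z ↦ ᵗ(cτ+d)⁻¹·z of ℂ^g maps the lattice ℤ^g + τ·ℤ^g bijectively onto the lattice ℤ^g + (M·τ)·ℤ^g, where M·τ = (aτ+b)(cτ+d)⁻¹. -/
open Complex Matrix

/-- Expansion used for both the transpose and the conjugate transpose. -/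
lemma sympl_expand {n : ℕ} (σ τ A B C D : Matrix (Fin n) (Fin n) ℂ)
    (h1 : Aᵀ * C = Cᵀ * A) (h2 : Bᵀ * D = Dᵀ * B) (h3 : Aᵀ * D - Cᵀ * B = 1)
    (h4 : Dᵀ * A - Bᵀ * C = 1) :
    (σ * Aᵀ + Bᵀ) * (C * τ + D) - (σ * Cᵀ + Dᵀ) * (A * τ + B) = σ - τ := by
  have : (σ * Aᵀ + Bᵀ) * (C * τ + D) - (σ * Cᵀ + Dᵀ) * (A * τ + B)
      = σ * (Aᵀ * C - Cᵀ * A) * τ + σ * (Aᵀ * D - Cᵀ * B) - (Dᵀ * A - Bᵀ * C) * τ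
        + (Bᵀ * D - Dᵀ * B) := by noncomm_ring
  rw [this, h1, h2, h3, h4]
  simp

/-- The block relations of a symplectic matrix. -/
lemma sympl_rel {n : ℕ} (M : Matrix (Fin n ⊕ Fin n) (Fin n ⊕ Fin n) ℤ)
    (hM : Mᵀ * Matrix.fromBlocks 0 1 (-1) 0 * M = Matrix.fromBlocks 0 1 (-1) 0) :
    (M.toBlocks₁₁ᵀ * M.toBlocks₂₁ = M.toBlocks₂₁ᵀ * M.toBlocks₁₁) ∧
    (M.toBlocks₁₂ᵀ * M.toBlocks₂₂ = M.toBlocks₂₂ᵀ * M.toBlocks₁₂) ∧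
    (M.toBlocks₁₁ᵀ * M.toBlocks₂₂ - M.toBlocks₂₁ᵀ * M.toBlocks₁₂ = 1) ∧
    (M.toBlocks₂₂ᵀ * M.toBlocks₁₁ - M.toBlocks₁₂ᵀ * M.toBlocks₂₁ = 1) := by
  rw [← Matrix.fromBlocks_toBlocks M] at hM
  rw [Matrix.fromBlocks_transpose, Matrix.fromBlocks_multiply, Matrix.fromBlocks_multiply,
    Matrix.fromBlocks_inj] at hM
  simp only [Matrix.mul_zero, Matrix.mul_one, Matrix.mul_neg, Matrix.neg_mul, zero_add,
    add_zero] at hM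
  obtain ⟨h1, h2, h3, h4⟩ := hM
  refine ⟨?_, ?_, ?_, ?_⟩
  · exact (neg_add_eq_zero.mp h1).symm
  · exact (neg_add_eq_zero.mp h4).symm
  · rw [← h2]; abel
  · rw [← neg_inj, ← h3]; abel

lemma sympl_cast_mul {n : ℕ} {X Y Z : Matrix (Fin n) (Fin n) ℤ} (h : Xᵀ * Y = Z) :
    (X.map (Int.cast : ℤ → ℂ))ᵀ * Y.map (Int.cast : ℤ → ℂ) = Z.map (Int.cast : ℤ → ℂ) := by
  rw [← h]
  ext i j
  simp [Matrix.mul_apply]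

lemma sympl_cast_sub {n : ℕ} {X Y Z W : Matrix (Fin n) (Fin n) ℤ} (h : Xᵀ * Y - Zᵀ * W = 1) :
    (X.map (Int.cast : ℤ → ℂ))ᵀ * Y.map (Int.cast : ℤ → ℂ)
      - (Z.map (Int.cast : ℤ → ℂ))ᵀ * W.map (Int.cast : ℤ → ℂ) = 1 := by
  rw [sympl_cast_mul rfl, sympl_cast_mul rfl]
  ext i j
  have := congrArg (Int.cast : ℤ → ℂ) (congrFun (congrFun h i) j)
  simp only [Matrix.sub_apply, Matrix.map_apply] at this ⊢
  rw [← Int.cast_sub] 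
  rw [show (Xᵀ * Y) i j - (Zᵀ * W) i j = (1 : Matrix (Fin n) (Fin n) ℤ) i j from
    congrFun (congrFun h i) j]
  simp [Matrix.one_apply]

lemma sympl_cast_conj {n : ℕ} (X : Matrix (Fin n) (Fin n) ℤ) :
    (X.map (Int.cast : ℤ → ℂ))ᴴ = (X.map (Int.cast : ℤ → ℂ))ᵀ := by
  ext i j
  simp

lemma sympl_cast_mulVec {n : ℕ} (X : Matrix (Fin n) (Fin n) ℤ) (v : Fin n → ℤ) :
    X.map (Int.cast : ℤ → ℂ) *ᵥ (fun i => (v i : ℂ)) = fun i => ((X *ᵥ v) i : ℂ) := by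
  ext i
  simp [Matrix.mulVec, dotProduct]

/-- Positivity of the complexified form. -/
lemma sympl_pos {n : ℕ} (τ : Matrix (Fin n) (Fin n) ℂ) (hsymm : τ.IsSymm)
    (hpos : (Matrix.of fun i j => (τ i j).im).PosDef) (v : Fin n → ℂ)
    (hv : star v ⬝ᵥ ((τᴴ - τ) *ᵥ v) = 0) : v = 0 := by
  have key : (fun i => (v i).re) ⬝ᵥ ((Matrix.of fun i j => (τ i j).im) *ᵥ fun i => (v i).re)
      + (fun i => (v i).im) ⬝ᵥ ((Matrix.of fun i j => (τ i j).im) *ᵥ fun i => (v i).im) = 0 := by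
    have h := congrArg Complex.im hv
    have hs : ∀ i j, τ j i = τ i j := fun i j => hsymm.apply i j
    simp only [dotProduct, Matrix.mulVec, Matrix.sub_apply, Matrix.conjTranspose_apply, hs,
      Finset.mul_sum, Complex.im_sum, Pi.star_apply, Complex.zero_im] at h
    simp only [dotProduct, Matrix.mulVec, Finset.mul_sum, Matrix.of_apply,
      ← Finset.sum_add_distrib]
    have h2 : (-2 : ℝ) * (∑ i, ∑ j, ((v i).re * ((τ i j).im * (v j).re)
        + (v i).im * ((τ i j).im * (v j).im))) = 0 := by
      rw [← h]
      simp only [Finset.mul_sum]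
      refine Finset.sum_congr rfl fun i _ => Finset.sum_congr rfl fun j _ => ?_
      simp
      ring
    linarith
  have nn : ∀ x : Fin n → ℝ, x ≠ 0 →
      0 < x ⬝ᵥ ((Matrix.of fun i j => (τ i j).im) *ᵥ x) := fun x hx => by
    simpa using hpos.dotProduct_mulVec_pos hx
  have nn' : ∀ x : Fin n → ℝ,
      0 ≤ x ⬝ᵥ ((Matrix.of fun i j => (τ i j).im) *ᵥ x) := fun x => by
    by_cases hx : x = 0
    · simp [hx]
    · exact (nn x hx).le
  have hre : (fun i => (v i).re) = 0 := by
    by_contra hx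
    linarith [nn _ hx, nn' fun i => (v i).im]
  have him : (fun i => (v i).im) = 0 := by
    by_contra hx
    linarith [nn _ hx, nn' fun i => (v i).re]
  ext i
  exact Complex.ext (congrFun hre i) (congrFun him i)

/-- **The symplectic action is compatible with the lattices.** For `M ∈ Sp(2g,ℤ)` and
`τ ∈ H_g`, the invertible complex-linear map `z ↦ ᵗ(cτ+d)⁻¹·z` of `ℂ^g` maps the
lattice `ℤ^g + τℤ^g` bijectively onto the lattice `ℤ^g + (M·τ)ℤ^g`, where
`M·τ = (aτ+b)(cτ+d)⁻¹`. -/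
theorem symplectic_map_lattice_bijOn (g : ℕ) (hg : 1 ≤ g)
    (τ : Matrix (Fin g) (Fin g) ℂ)
    (hsymm : τ.IsSymm)
    (hpos : (Matrix.of fun i j => (τ i j).im).PosDef)
    (M : Matrix (Fin g ⊕ Fin g) (Fin g ⊕ Fin g) ℤ)
    (hM : Mᵀ * Matrix.fromBlocks 0 1 (-1) 0 * M = Matrix.fromBlocks 0 1 (-1) 0)
    (A B C D : Matrix (Fin g) (Fin g) ℂ)
    (hA : A = (M.toBlocks₁₁).map (Int.cast : ℤ → ℂ))
    (hB : B = (M.toBlocks₁₂).map (Int.cast : ℤ → ℂ))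
    (hC : C = (M.toBlocks₂₁).map (Int.cast : ℤ → ℂ))
    (hD : D = (M.toBlocks₂₂).map (Int.cast : ℤ → ℂ))
    (τ' : Matrix (Fin g) (Fin g) ℂ) (hτ' : τ' = (A * τ + B) * (C * τ + D)⁻¹)
    (L L' : Set (Fin g → ℂ))
    (hL : L = {v : Fin g → ℂ | ∃ m n : Fin g → ℤ,
      v = fun i => (n i : ℂ) + ∑ j, τ i j * (m j : ℂ)})
    (hL' : L' = {v : Fin g → ℂ | ∃ m n : Fin g → ℤ,
      v = fun i => (n i : ℂ) + ∑ j, τ' i j * (m j : ℂ)}) :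
    IsUnit (C * τ + D).det ∧
    Set.BijOn (fun z : Fin g → ℂ => ((C * τ + D)ᵀ)⁻¹.mulVec z) L L' := by
  obtain ⟨r1, r2, r3, r4⟩ := sympl_rel M hM
  have h1 : Aᵀ * C = Cᵀ * A := by
    rw [hA, hC, sympl_cast_mul r1, sympl_cast_mul rfl]
  have h2 : Bᵀ * D = Dᵀ * B := by
    rw [hB, hD, sympl_cast_mul r2, sympl_cast_mul rfl]
  have h3 : Aᵀ * D - Cᵀ * B = 1 := by
    rw [hA, hB, hC, hD]; exact sympl_cast_sub r3
  have h4 : Dᵀ * A - Bᵀ * C = 1 := by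
    rw [hA, hB, hC, hD]; exact sympl_cast_sub r4
  have hdet : IsUnit (C * τ + D).det := by
    rw [isUnit_iff_ne_zero]
    intro h0
    obtain ⟨v, hv0, hv⟩ := Matrix.exists_mulVec_eq_zero_iff.mpr h0
    apply hv0
    apply sympl_pos τ hsymm hpos
    have e1 : (C * τ + D)ᴴ = τᴴ * Cᵀ + Dᵀ := by
      rw [Matrix.conjTranspose_add, Matrix.conjTranspose_mul, hC, hD, sympl_cast_conj,
        sympl_cast_conj]
    rw [← sympl_expand τᴴ τ A B C D h1 h2 h3 h4, ← e1, Matrix.sub_mulVec,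
      ← Matrix.mulVec_mulVec, ← Matrix.mulVec_mulVec, hv, Matrix.mulVec_zero, zero_sub,
      dotProduct_neg, Matrix.dotProduct_mulVec, ← Matrix.star_mulVec, hv]
    simp
  refine ⟨hdet, ?_⟩
  have hdetT : IsUnit ((C * τ + D)ᵀ).det := by rwa [Matrix.det_transpose]
  have ht : τᵀ = τ := hsymm
  have eQ : (C * τ + D)ᵀ = τ * Cᵀ + Dᵀ := by
    rw [Matrix.transpose_add, Matrix.transpose_mul, ht]
  -- the key identity for the new period matrix
  have hPQ : (C * τ + D)ᵀ * τ' = τ * Aᵀ + Bᵀ := by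
    have h := sympl_expand τ τ A B C D h1 h2 h3 h4
    rw [sub_self, sub_eq_zero] at h
    rw [hτ', eQ, ← Matrix.mul_assoc, ← h, Matrix.mul_nonsing_inv_cancel_right _ _ hdet]
  have lat : ∀ (σ : Matrix (Fin g) (Fin g) ℂ) (m n : Fin g → ℤ),
      (fun i => (n i : ℂ) + ∑ j, σ i j * (m j : ℂ))
        = (fun i => (n i : ℂ)) + σ *ᵥ (fun i => (m i : ℂ)) := by
    intro σ m n
    ext i
    simp [Matrix.mulVec, dotProduct]
  simp only [lat] at hL hL'
  have hmap : ∀ m n : Fin g → ℤ,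
      (C * τ + D)ᵀ *ᵥ ((fun i => (n i : ℂ)) + τ' *ᵥ (fun i => (m i : ℂ)))
        = (fun i => ((M.toBlocks₂₂ᵀ *ᵥ n + M.toBlocks₁₂ᵀ *ᵥ m) i : ℂ))
          + τ *ᵥ (fun i => ((M.toBlocks₂₁ᵀ *ᵥ n + M.toBlocks₁₁ᵀ *ᵥ m) i : ℂ)) := by
    intro m n
    have s : ∀ (X Y : Matrix (Fin g) (Fin g) ℤ), 
        (fun i => ((Xᵀ *ᵥ n + Yᵀ *ᵥ m) i : ℂ))
          = (X.map (Int.cast : ℤ → ℂ))ᵀ *ᵥ (fun i => (n i : ℂ))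
            + (Y.map (Int.cast : ℤ → ℂ))ᵀ *ᵥ (fun i => (m i : ℂ)) := by
      intro X Y
      rw [← Matrix.transpose_map, ← Matrix.transpose_map, sympl_cast_mulVec, sympl_cast_mulVec]
      ext i
      simp
    rw [s, s, ← hA, ← hB, ← hC, ← hD, Matrix.mulVec_add, Matrix.mulVec_mulVec, hPQ, eQ]
    simp only [Matrix.add_mulVec, Matrix.mulVec_add, Matrix.mulVec_mulVec]
    abel
  have cancel : ∀ w, ((C * τ + D)ᵀ)⁻¹ *ᵥ ((C * τ + D)ᵀ *ᵥ w) = w := fun w => by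
    rw [Matrix.mulVec_mulVec, Matrix.nonsing_inv_mul _ hdetT, Matrix.one_mulVec]
  have cancel' : ∀ w, (C * τ + D)ᵀ *ᵥ (((C * τ + D)ᵀ)⁻¹ *ᵥ w) = w := fun w => by
    rw [Matrix.mulVec_mulVec, Matrix.mul_nonsing_inv _ hdetT, Matrix.one_mulVec]
  refine ⟨?_, ?_, ?_⟩
  · intro z hz
    rw [hL] at hz
    obtain ⟨m, n, rfl⟩ := hz
    rw [hL']
    refine ⟨M.toBlocks₂₂ *ᵥ m - M.toBlocks₂₁ *ᵥ n, M.toBlocks₁₁ *ᵥ n - M.toBlocks₁₂ *ᵥ m, ?_⟩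
    rw [← cancel ((fun i => (((M.toBlocks₁₁ *ᵥ n - M.toBlocks₁₂ *ᵥ m) i : ℤ) : ℂ)) + _), hmap]
    have k1 : M.toBlocks₂₂ᵀ *ᵥ (M.toBlocks₁₁ *ᵥ n - M.toBlocks₁₂ *ᵥ m)
        + M.toBlocks₁₂ᵀ *ᵥ (M.toBlocks₂₂ *ᵥ m - M.toBlocks₂₁ *ᵥ n) = n := by
      simp only [Matrix.mulVec_sub, Matrix.mulVec_mulVec]
      rw [r2]
      have : n = (M.toBlocks₂₂ᵀ * M.toBlocks₁₁ - M.toBlocks₁₂ᵀ * M.toBlocks₂₁) *ᵥ n := by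
        rw [r4, Matrix.one_mulVec]
      conv_rhs => rw [this, Matrix.sub_mulVec]
      abel
    have k2 : M.toBlocks₂₁ᵀ *ᵥ (M.toBlocks₁₁ *ᵥ n - M.toBlocks₁₂ *ᵥ m)
        + M.toBlocks₁₁ᵀ *ᵥ (M.toBlocks₂₂ *ᵥ m - M.toBlocks₂₁ *ᵥ n) = m := by
      simp only [Matrix.mulVec_sub, Matrix.mulVec_mulVec]
      rw [r1]
      have : m = (M.toBlocks₁₁ᵀ * M.toBlocks₂₂ - M.toBlocks₂₁ᵀ * M.toBlocks₁₂) *ᵥ m := by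
        rw [r3, Matrix.one_mulVec]
      conv_rhs => rw [this, Matrix.sub_mulVec]
      abel
    rw [k1, k2]
  · intro z _ w _ h
    rw [← cancel' z, ← cancel' w]
    exact congrArg _ h
  · intro z hz
    rw [hL'] at hz
    obtain ⟨m, n, rfl⟩ := hz
    refine ⟨_, ?_, cancel _⟩
    rw [hL, hmap]
    exact ⟨_, _, rfl⟩
end

section
/- Let k be a field with at least 4 elements and let n ≥ 2. Then SL_n(k) is contained in the commutator subgroup of GL_n(k); consequently, every group homomorphism from GL_n(k) to an abelian group is trivial on SL_n(k). -/
open Matrix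
open scoped commutatorElement

theorem aux_mem_comm {G : Type*} [Group G] {d x t : G} (h : d * x = t * x * d) :
    t ∈ commutator G := by
  have : t = ⁅d, x⁆ := by
    rw [commutatorElement_def, h]; group
  rw [this]
  exact Subgroup.commutator_mem_commutator (Subgroup.mem_top _) (Subgroup.mem_top _)

/-- The diagonal matrix with `a` at place `i` and `1` elsewhere. -/
noncomputable def auxDil {k : Type*} [Field k] {n : ℕ} (i : Fin n) (a : k) (ha : a ≠ 0) :
    GL (Fin n) k :=
  Matrix.GeneralLinearGroup.mkOfDetNeZero (diagonal (fun l => if l = i then a else 1))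
    (by simp [det_diagonal, ha])

theorem auxDil_coe {k : Type*} [Field k] {n : ℕ} (i : Fin n) (a : k) (ha : a ≠ 0) :
    (auxDil i a ha : Matrix (Fin n) (Fin n) k) = diagonal (fun l => if l = i then a else 1) := rfl

theorem aux_main
    (k : Type*) [Field k] (hk : 4 ≤ Cardinal.mk k) (n : ℕ) (hn : 2 ≤ n)
    (M : SpecialLinearGroup (Fin n) k) :
    (M : GL (Fin n) k) ∈ commutator (GL (Fin n) k) := by
  have : Nontrivial (Fin n) := Fin.nontrivial_iff_two_le.2 hn
  obtain ⟨a, ha0, ha1⟩ : ∃ a : k, a ≠ 0 ∧ a ≠ 1 := by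
    by_contra! h
    have h2 : (Set.univ : Set k) ⊆ {0, 1} := fun x _ => by
      by_cases hx : x = 0
      · simp [hx]
      · simp [h x hx]
    have h3 := Cardinal.mk_le_mk_of_subset h2
    rw [Cardinal.mk_univ] at h3
    have h4 : Cardinal.mk ({0, 1} : Set k) ≤ 2 := by
      rw [Cardinal.mk_insert (by simp), Cardinal.mk_singleton]
      norm_num
    have h5 := hk.trans (h3.trans h4)
    norm_num at h5
  refine SpecialLinearGroup.diagonal_transvection_induction'
    (fun M => (M : GL (Fin n) k) ∈ commutator (GL (Fin n) k)) M ?_ ?_ ?_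
  · intro i j hij c hc
    apply aux_mem_comm (d := auxDil i c hc) (x := Matrix.GeneralLinearGroup.swap k i j)
    have e : ((SpecialLinearGroup.diag2n hij c hc : SpecialLinearGroup (Fin n) k) :
        GL (Fin n) k).val =
        diagonal (fun l => if l = i then c else if l = j then c⁻¹ else 1) := rfl
    have e2 : (Matrix.GeneralLinearGroup.swap k i j).val = Matrix.swap k i j := rfl
    ext p q
    rw [Units.val_mul, Units.val_mul, Units.val_mul, auxDil_coe, e, e2, diagonal_mul,
      mul_diagonal, diagonal_mul]
    have e3 : Matrix.swap k i j p q = if Equiv.swap i j p = q then 1 else 0 := by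
      simp [Matrix.swap, PEquiv.toMatrix_apply]
    rw [e3, Equiv.swap_apply_def]
    grind
  · intro i j hij c
    apply aux_mem_comm (d := auxDil i a ha0)
      (x := (SpecialLinearGroup.transvection hij (c / (a - 1)) : SpecialLinearGroup (Fin n) k))
    have h1 : a - 1 ≠ 0 := sub_ne_zero.2 ha1
    rw [← map_mul, ← SpecialLinearGroup.transvection_add]
    ext p q
    simp [auxDil_coe, SpecialLinearGroup.transvection_coe, diagonal_mul, mul_diagonal, one_apply,
      single_apply]
    grind
  · intro A B hA hB
    simpa using mul_mem hA hB

/-- **`SL_n(k)` lies in the commutator subgroup of `GL_n(k)`** for a field `k` with at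
least `4` elements and `n ≥ 2`; consequently every homomorphism from `GL_n(k)` to an
abelian group is trivial on `SL_n(k)`. -/
theorem specialLinear_le_commutator_generalLinear
    (k : Type*) [Field k] (hk : 4 ≤ Cardinal.mk k) (n : ℕ) (hn : 2 ≤ n) :
    (∀ u : GL (Fin n) k, (u : Matrix (Fin n) (Fin n) k).det = 1 →
      u ∈ commutator (GL (Fin n) k)) ∧
    (∀ (A : Type) [CommGroup A] (φ : GL (Fin n) k →* A),
      ∀ u : GL (Fin n) k, (u : Matrix (Fin n) (Fin n) k).det = 1 → φ u = 1) := by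
  have key : ∀ u : GL (Fin n) k, (u : Matrix (Fin n) (Fin n) k).det = 1 →
      u ∈ commutator (GL (Fin n) k) := by
    intro u hu
    have h := aux_main k hk n hn (⟨u.val, hu⟩ : SpecialLinearGroup (Fin n) k)
    have e : SpecialLinearGroup.toGL (⟨u.val, hu⟩ : SpecialLinearGroup (Fin n) k) = u := by
      ext; rfl
    rwa [e] at h
  exact ⟨key, fun A _ φ u hu => Abelianization.commutator_subset_ker φ (key u hu)⟩
end
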